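/- arXiv:1609.08079 — 4 statements merged into one kernel-verified Lean document; each statement's English description precedes it below -/
import Mathlib

section
/- Let A be an m×n matrix with all entries equal to 0 or 1, with row index set R and column index set C, having no all-zero row and no all-zero column. For nonempty X ⊆ R and Y ⊆ C define the cut a(X,Y) = Σ_{i∈X} Σ_{j∈Y} a_{ij}, the volumes V(X) = Σ_{i∈X} Σ_{j∈C} a_{ij} and V(Y) = Σ_{i∈R} Σ_{j∈Y} a_{ij}, and the density d(X,Y) = a(X,Y)/(V(X)·V(Y)). Then for any real 0 < δ < 1/4 and any nonempty X* ⊆ X ⊆ R and Y* ⊆ Y ⊆ C with V(X*)/V(X) ≥ 1−δ and V(Y*)/V(Y) ≥ 1−δ, one has |d(X,Y) − d(X*,Y*)| ≤ 4δ. -/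
open Finset

/-- The cut `a(X,Y)` between a row-subset `X` and a column-subset `Y`. -/
noncomputable def cut {m n : ℕ} (A : Matrix (Fin m) (Fin n) ℝ)
    (X : Finset (Fin m)) (Y : Finset (Fin n)) : ℝ :=
  ∑ i ∈ X, ∑ j ∈ Y, A i j

/-- The volume `V(X)` of a row-subset `X`. -/
noncomputable def rowVol {m n : ℕ} (A : Matrix (Fin m) (Fin n) ℝ)
    (X : Finset (Fin m)) : ℝ :=
  ∑ i ∈ X, ∑ j, A i j

/-- The volume `V(Y)` of a column-subset `Y`. -/
noncomputable def colVol {m n : ℕ} (A : Matrix (Fin m) (Fin n) ℝ)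
    (Y : Finset (Fin n)) : ℝ :=
  ∑ j ∈ Y, ∑ i, A i j

/-- The density `d(X,Y) = a(X,Y)/(V(X)·V(Y))`. -/
noncomputable def density {m n : ℕ} (A : Matrix (Fin m) (Fin n) ℝ)
    (X : Finset (Fin m)) (Y : Finset (Fin n)) : ℝ :=
  cut A X Y / (rowVol A X * colVol A Y)

lemma aux_real (c c' P Q p q δ : ℝ) (hδ0 : 0 < δ) (hδ : δ < 1 / 4) (hp : 1 ≤ p) (hq : 1 ≤ q)
    (hpP : p ≤ P) (hqQ : q ≤ Q) (h1 : (1 - δ) * P ≤ p) (h2 : (1 - δ) * Q ≤ q)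
    (hc0 : 0 ≤ c') (hcc : c' ≤ c) (hcp : c' ≤ p) (hd : c ≤ c' + (P - p) + (Q - q)) :
    |c / (P * Q) - c' / (p * q)| ≤ 4 * δ := by
  have hP : 1 ≤ P := hp.trans hpP
  have hQ : 1 ≤ Q := hq.trans hqQ
  have hPQ : 0 < P * Q := by positivity
  have hpq : 0 < p * q := by positivity
  have hle : p * q ≤ P * Q := by gcongr
  rw [abs_le]
  constructor
  · have e1 : c' / (P * Q) ≤ c / (P * Q) := by gcongr
    have e2 : c' / (p * q) - c' / (P * Q) = c' / (p * q) * (1 - p * q / (P * Q)) := by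
      field_simp
    have e3 : c' / (p * q) ≤ 1 := by
      rw [div_le_one hpq]; nlinarith
    have e4 : 0 ≤ 1 - p * q / (P * Q) := by
      rw [sub_nonneg, div_le_one hPQ]; exact hle
    have e5 : (1 - δ) ^ 2 ≤ p * q / (P * Q) := by
      rw [le_div_iff₀ hPQ]
      have : ((1 - δ) * P) * ((1 - δ) * Q) ≤ p * q :=
        mul_le_mul h1 h2 (mul_nonneg (by linarith) (by linarith)) (by linarith)
      linarith
    have e6 := mul_le_mul_of_nonneg_right e3 e4
    nlinarith
  · have e1 : c' / (P * Q) ≤ c' / (p * q) := by gcongr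
    have e2 : c / (P * Q) - c' / (P * Q) ≤ 2 * δ := by
      rw [← sub_div, div_le_iff₀ hPQ]
      have : P + Q ≤ 2 * (P * Q) := by nlinarith
      nlinarith
    linarith

/-- Continuity of the density for binary arrays. -/
theorem density_continuity {m n : ℕ} (A : Matrix (Fin m) (Fin n) ℝ)
    (hbin : ∀ i j, A i j = 0 ∨ A i j = 1)
    (hrow : ∀ i, ∃ j, A i j ≠ 0)
    (hcol : ∀ j, ∃ i, A i j ≠ 0)
    (δ : ℝ) (hδ0 : 0 < δ) (hδ : δ < 1 / 4)
    (X' X : Finset (Fin m)) (Y' Y : Finset (Fin n))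
    (hX'ne : X'.Nonempty) (hX'X : X' ⊆ X)
    (hY'ne : Y'.Nonempty) (hY'Y : Y' ⊆ Y)
    (hVX : rowVol A X' / rowVol A X ≥ 1 - δ)
    (hVY : colVol A Y' / colVol A Y ≥ 1 - δ) :
    |density A X Y - density A X' Y'| ≤ 4 * δ := by
  have h0 : ∀ i j, 0 ≤ A i j := fun i j => by rcases hbin i j with h | h <;> simp [h]
  have hr0 : ∀ i, 0 ≤ ∑ j, A i j := fun i => sum_nonneg fun j _ => h0 i j
  have hk0 : ∀ j, 0 ≤ ∑ i, A i j := fun j => sum_nonneg fun i _ => h0 i j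
  have hr1 : ∀ i, 1 ≤ ∑ j, A i j := fun i => by
    obtain ⟨j, hj⟩ := hrow i
    have := single_le_sum (f := fun j => A i j) (fun j _ => h0 i j) (mem_univ j)
    rcases hbin i j with h | h
    · exact absurd h hj
    · simpa [h] using this
  have hk1 : ∀ j, 1 ≤ ∑ i, A i j := fun j => by
    obtain ⟨i, hi⟩ := hcol j
    have := single_le_sum (f := fun i => A i j) (fun i _ => h0 i j) (mem_univ i)
    rcases hbin i j with h | h
    · exact absurd h hi
    · simpa [h] using this
  have hp : 1 ≤ rowVol A X' := by
    obtain ⟨i, hi⟩ := hX'ne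
    exact (hr1 i).trans (single_le_sum (f := fun i => ∑ j, A i j) (fun i _ => hr0 i) hi)
  have hq : 1 ≤ colVol A Y' := by
    obtain ⟨j, hj⟩ := hY'ne
    exact (hk1 j).trans (single_le_sum (f := fun j => ∑ i, A i j) (fun j _ => hk0 j) hj)
  have hpP : rowVol A X' ≤ rowVol A X := sum_le_sum_of_subset_of_nonneg hX'X fun i _ _ => hr0 i
  have hqQ : colVol A Y' ≤ colVol A Y := sum_le_sum_of_subset_of_nonneg hY'Y fun i _ _ => hk0 i
  have cutrow : ∀ (S : Finset (Fin m)) (T : Finset (Fin n)), cut A S T ≤ rowVol A S :=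
    fun S T => sum_le_sum fun i _ =>
      sum_le_sum_of_subset_of_nonneg (subset_univ T) fun j _ _ => h0 i j
  have cutcol : ∀ (S : Finset (Fin m)) (T : Finset (Fin n)), cut A S T ≤ colVol A T :=
    fun S T => by
      have e : cut A S T = ∑ j ∈ T, ∑ i ∈ S, A i j := sum_comm
      refine e.le.trans ?_
      exact sum_le_sum fun j _ =>
        sum_le_sum_of_subset_of_nonneg (subset_univ S) fun i _ _ => h0 i j
  have cut0 : ∀ (S : Finset (Fin m)) (T : Finset (Fin n)), 0 ≤ cut A S T :=
    fun S T => sum_nonneg fun i _ => sum_nonneg fun j _ => h0 i j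
  have s1 : cut A (X \ X') Y + cut A X' Y = cut A X Y := sum_sdiff hX'X
  have s2 : cut A X' (Y \ Y') + cut A X' Y' = cut A X' Y := by
    unfold cut
    rw [← sum_add_distrib]
    exact sum_congr rfl fun i _ => sum_sdiff hY'Y
  have s3 : rowVol A (X \ X') + rowVol A X' = rowVol A X := sum_sdiff hX'X
  have s4 : colVol A (Y \ Y') + colVol A Y' = colVol A Y := sum_sdiff hY'Y
  have t1 := cutrow (X \ X') Y
  have t2 := cutcol X' (Y \ Y')
  have t3 := cut0 (X \ X') Y
  have t4 := cut0 X' (Y \ Y')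
  refine aux_real _ _ _ _ _ _ δ hδ0 hδ hp hq hpP hqQ ?_ ?_ (cut0 X' Y') (by linarith)
    (cutrow X' Y') (by linarith)
  · exact (le_div_iff₀ (by linarith)).1 hVX
  · exact (le_div_iff₀ (by linarith)).1 hVY
end

section
/- Let A be an m×n matrix with all entries equal to 0 or 1, with no all-zero row and no all-zero column. For nonempty X* ⊆ X ⊆ R and Y* ⊆ Y ⊆ C with V(X*)/V(X) ≥ 1−δ and V(Y*)/V(Y) ≥ 1−δ, where 0 < δ < 1, the densities satisfy the lower bound d(X*,Y*) ≥ (1/(1−δ))²·(d(X,Y) − 1) + 1. -/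
open Finset

theorem vol_sub_cut {m n : ℕ} (A : Matrix (Fin m) (Fin n) ℝ)
    (X : Finset (Fin m)) (Y : Finset (Fin n)) :
    rowVol A X * colVol A Y - cut A X Y =
      ∑ p ∈ X ×ˢ Y, ((∑ j, A p.1 j) * (∑ i, A i p.2) - A p.1 p.2) := by
  unfold rowVol colVol cut
  rw [Finset.sum_sub_distrib, Finset.sum_mul_sum, Finset.sum_product, Finset.sum_product]

/-- Lower bound on the density of the smaller sets. -/
theorem density_lower_bound {m n : ℕ} (A : Matrix (Fin m) (Fin n) ℝ)
    (hbin : ∀ i j, A i j = 0 ∨ A i j = 1)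
    (hrow : ∀ i, ∃ j, A i j ≠ 0)
    (hcol : ∀ j, ∃ i, A i j ≠ 0)
    (δ : ℝ) (hδ0 : 0 < δ) (hδ : δ < 1)
    (X' X : Finset (Fin m)) (Y' Y : Finset (Fin n))
    (hX'ne : X'.Nonempty) (hX'X : X' ⊆ X)
    (hY'ne : Y'.Nonempty) (hY'Y : Y' ⊆ Y)
    (hVX : rowVol A X' / rowVol A X ≥ 1 - δ)
    (hVY : colVol A Y' / colVol A Y ≥ 1 - δ) :
    density A X' Y' ≥ (1 / (1 - δ)) ^ 2 * (density A X Y - 1) + 1 := by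
  have h0 : ∀ i j, 0 ≤ A i j := fun i j => by rcases hbin i j with h | h <;> simp [h]
  have hr : ∀ i, 0 < ∑ j, A i j := fun i => by
    obtain ⟨j, hj⟩ := hrow i
    exact Finset.sum_pos' (fun j _ => h0 i j) ⟨j, mem_univ _, lt_of_le_of_ne (h0 i j) hj.symm⟩
  have hc : ∀ j, 0 < ∑ i, A i j := fun j => by
    obtain ⟨i, hi⟩ := hcol j
    exact Finset.sum_pos' (fun i _ => h0 i j) ⟨i, mem_univ _, lt_of_le_of_ne (h0 i j) hi.symm⟩
  have hterm : ∀ i j, 0 ≤ (∑ j, A i j) * (∑ i, A i j) - A i j := fun i j => by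
    rcases hbin i j with h | h
    · rw [h, sub_zero]; exact (mul_pos (hr i) (hc j)).le
    · have h1 : A i j ≤ ∑ j, A i j :=
        Finset.single_le_sum (f := fun j => A i j) (fun j _ => h0 i j) (mem_univ j)
      have h2 : A i j ≤ ∑ i, A i j :=
        Finset.single_le_sum (f := fun i => A i j) (fun i _ => h0 i j) (mem_univ i)
      rw [h] at h1 h2 ⊢
      nlinarith
  have hF : rowVol A X' * colVol A Y' - cut A X' Y' ≤ rowVol A X * colVol A Y - cut A X Y := by
    rw [vol_sub_cut, vol_sub_cut]
    exact Finset.sum_le_sum_of_subset_of_nonneg (Finset.product_subset_product hX'X hY'Y)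
      (fun p _ _ => hterm p.1 p.2)
  have hF0 : 0 ≤ rowVol A X * colVol A Y - cut A X Y := by
    rw [vol_sub_cut]
    exact Finset.sum_nonneg (fun p _ => hterm p.1 p.2)
  have a1 : 0 < rowVol A X' := Finset.sum_pos (fun i _ => hr i) hX'ne
  have a2 : 0 < rowVol A X := Finset.sum_pos (fun i _ => hr i) (hX'ne.mono hX'X)
  have b1 : 0 < colVol A Y' := Finset.sum_pos (fun i _ => hc i) hY'ne
  have b2 : 0 < colVol A Y := Finset.sum_pos (fun i _ => hc i) (hY'ne.mono hY'Y)
  have hd : 0 < 1 - δ := by linarith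
  rw [ge_iff_le, le_div_iff₀ a2] at hVX
  rw [ge_iff_le, le_div_iff₀ b2] at hVY
  have hP : (1 - δ) ^ 2 * (rowVol A X * colVol A Y) ≤ rowVol A X' * colVol A Y' := by
    have := mul_le_mul hVX hVY (by positivity) a1.le
    linarith
  unfold density
  generalize rowVol A X = x at *
  generalize rowVol A X' = x' at *
  generalize colVol A Y = y at *
  generalize colVol A Y' = y' at *
  generalize cut A X Y = c at *
  generalize cut A X' Y' = c' at *
  have key : (x' * y' - c') / (x' * y') ≤ (x * y - c) / ((1 - δ) ^ 2 * (x * y)) :=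
    div_le_div₀ hF0 hF (by positivity) hP
  have e1 : (x' * y' - c') / (x' * y') = 1 - c' / (x' * y') := by field_simp
  have e2 : (x * y - c) / ((1 - δ) ^ 2 * (x * y)) = (1 / (1 - δ)) ^ 2 * (1 - c / (x * y)) := by
    field_simp
  rw [e1, e2] at key
  linarith
end

section
/- Let A be an m×n matrix of nonnegative real entries with Σ_{i∈R} Σ_{j∈C} a_{ij} = 1 and with all row-sums d_row,i and column-sums d_col,j positive. Let 0 < δ < 1, let X* ⊆ X ⊆ R and Y* ⊆ Y ⊆ C be nonempty with Vol(X*)/Vol(X) ≥ 1−δ and Vol(Y*)/Vol(Y) ≥ 1−δ, and let K be any real number such that ρ(X',Y') ≤ K for all nonempty X' ⊆ R and Y' ⊆ C. Then the densities satisfy (ρ(X,Y) − K)·(1/(1−δ)² − 1) ≤ ρ(X*,Y*) − ρ(X,Y) ≤ ρ(X,Y)·(1/(1−δ)² − 1). -/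
open Finset

lemma cut_le_of_density_le {m n : ℕ} (A : Matrix (Fin m) (Fin n) ℝ)
    (hrow : ∀ i, 0 < ∑ j, A i j)
    (hcol : ∀ j, 0 < ∑ i, A i j) (K : ℝ)
    (hK : ∀ (X'' : Finset (Fin m)) (Y'' : Finset (Fin n)),
      X''.Nonempty → Y''.Nonempty → density A X'' Y'' ≤ K)
    (X : Finset (Fin m)) (Y : Finset (Fin n)) :
    cut A X Y ≤ K * (rowVol A X * colVol A Y) := by
  rcases X.eq_empty_or_nonempty with rfl | hX
  · simp [cut, rowVol]
  rcases Y.eq_empty_or_nonempty with rfl | hY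
  · simp [cut, colVol]
  have h1 : 0 < rowVol A X := Finset.sum_pos (fun i _ => hrow i) hX
  have h2 : 0 < colVol A Y := Finset.sum_pos (fun i _ => hcol i) hY
  exact (div_le_iff₀ (mul_pos h1 h2)).1 (hK X Y hX hY)

/-- Two-sided bound on the change of density, in terms of a uniform upper
bound `K` on all densities. -/
theorem density_change_bounds {m n : ℕ} (A : Matrix (Fin m) (Fin n) ℝ)
    (hA : ∀ i j, 0 ≤ A i j)
    (hsum : ∑ i, ∑ j, A i j = 1)
    (hrow : ∀ i, 0 < ∑ j, A i j)
    (hcol : ∀ j, 0 < ∑ i, A i j)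
    (δ : ℝ) (hδ0 : 0 < δ) (hδ : δ < 1)
    (X' X : Finset (Fin m)) (Y' Y : Finset (Fin n))
    (hX'ne : X'.Nonempty) (hX'X : X' ⊆ X)
    (hY'ne : Y'.Nonempty) (hY'Y : Y' ⊆ Y)
    (hVX : rowVol A X' / rowVol A X ≥ 1 - δ)
    (hVY : colVol A Y' / colVol A Y ≥ 1 - δ)
    (K : ℝ)
    (hK : ∀ (X'' : Finset (Fin m)) (Y'' : Finset (Fin n)),
      X''.Nonempty → Y''.Nonempty → density A X'' Y'' ≤ K) :
    (density A X Y - K) * (1 / (1 - δ) ^ 2 - 1) ≤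
        density A X' Y' - density A X Y ∧
      density A X' Y' - density A X Y ≤
        density A X Y * (1 / (1 - δ) ^ 2 - 1) := by
  have hp : 0 < rowVol A X' := Finset.sum_pos (fun i _ => hrow i) hX'ne
  have hq : 0 < colVol A Y' := Finset.sum_pos (fun i _ => hcol i) hY'ne
  have hP : 0 < rowVol A X := Finset.sum_pos (fun i _ => hrow i) (hX'ne.mono hX'X)
  have hQ : 0 < colVol A Y := Finset.sum_pos (fun i _ => hcol i) (hY'ne.mono hY'Y)
  have eP : rowVol A (X \ X') + rowVol A X' = rowVol A X := Finset.sum_sdiff hX'X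
  have eQ : colVol A (Y \ Y') + colVol A Y' = colVol A Y := Finset.sum_sdiff hY'Y
  have e1 : cut A (X \ X') Y + cut A X' Y = cut A X Y := Finset.sum_sdiff hX'X
  have e2 : cut A X' (Y \ Y') + cut A X' Y' = cut A X' Y := by
    unfold cut
    rw [← Finset.sum_add_distrib]
    exact Finset.sum_congr rfl fun i _ => Finset.sum_sdiff hY'Y
  have n0 : ∀ U W, 0 ≤ cut A U W := fun U W =>
    Finset.sum_nonneg fun i _ => Finset.sum_nonneg fun j _ => hA i j
  have k1 := cut_le_of_density_le A hrow hcol K hK (X \ X') Y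
  have k2 := cut_le_of_density_le A hrow hcol K hK X' (Y \ Y')
  have hle := hK X Y (hX'ne.mono hX'X) (hY'ne.mono hY'Y)
  have c1 := n0 (X \ X') Y
  have c2 := n0 X' (Y \ Y')
  have c0 := n0 X Y
  rw [ge_iff_le, le_div_iff₀ hP] at hVX
  rw [ge_iff_le, le_div_iff₀ hQ] at hVY
  have hV : 0 < rowVol A X * colVol A Y := mul_pos hP hQ
  have hv : 0 < rowVol A X' * colVol A Y' := mul_pos hp hq
  have hd : 0 < 1 - δ := by linarith
  have hvV : (1 - δ) ^ 2 * (rowVol A X * colVol A Y) ≤ rowVol A X' * colVol A Y' := by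
    calc _ = ((1 - δ) * rowVol A X) * ((1 - δ) * colVol A Y) := by ring
      _ ≤ _ := mul_le_mul hVX hVY (by positivity) hp.le
  have hcc : cut A X' Y' ≤ cut A X Y := by linarith
  have hdiff : cut A X Y - cut A X' Y' ≤
      K * (rowVol A X * colVol A Y - rowVol A X' * colVol A Y') := by
    have : K * (rowVol A X * colVol A Y - rowVol A X' * colVol A Y') =
      K * (rowVol A (X \ X') * colVol A Y) + K * (rowVol A X' * colVol A (Y \ Y')) := by
      rw [← eP, ← eQ]; ring
    linarith
  have hr : rowVol A X * colVol A Y / (rowVol A X' * colVol A Y') ≤ 1 / (1 - δ) ^ 2 := by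
    rw [div_le_div_iff₀ hv (by positivity)]; linarith
  have hc : cut A X Y = density A X Y * (rowVol A X * colVol A Y) := by
    unfold density; field_simp
  have hρ : 0 ≤ density A X Y := div_nonneg c0 hV.le
  have hρ' : density A X' Y' = cut A X' Y' / (rowVol A X' * colVol A Y') := rfl
  generalize density A X Y = r at *
  generalize rowVol A X * colVol A Y = V at *
  generalize rowVol A X' * colVol A Y' = v at *
  constructor
  · have a1 : (r - K) * (1 / (1 - δ) ^ 2 - 1) ≤ (r - K) * (V / v - 1) :=
      mul_le_mul_of_nonpos_left (by linarith) (by linarith)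
    have a2 : (r - K) * (V / v - 1) ≤ density A X' Y' - r := by
      rw [hρ', ← sub_nonneg]
      have : cut A X' Y' / v - r - (r - K) * (V / v - 1) =
        (cut A X' Y' - r * V + K * (V - v)) / v := by field_simp; ring
      rw [this]
      exact div_nonneg (by linarith) hv.le
    linarith
  · have a1 : r * (V / v) ≤ r * (1 / (1 - δ) ^ 2) := mul_le_mul_of_nonneg_left hr hρ
    have a2 : density A X' Y' ≤ r * (V / v) := by
      rw [hρ', ← mul_div_assoc]
      exact div_le_div_of_nonneg_right (by linarith) hv.le
    linarith
end

section
/- Let A be an m×n matrix of nonnegative real entries with total sum 1 and all row-sums and column-sums positive, and let (R₁,…,R_k) and (C₁,…,C_k) be proper k-partitions of the rows and columns. For 1 ≤ a,b ≤ k set s_{ab} = Σ_{i∈R_a} Σ_{j∈C_b} a_{ij}, and suppose the k×k matrix (s_{ab}) is an independent table, i.e., s_{ab} = (Σ_c s_{ac})·(Σ_c s_{cb}) for all a,b. Then ρ(R_a, C_b) = 1 for all 1 ≤ a,b ≤ k, and consequently disc(X,Y; R_a, C_b) = disc(X,Y; R, C) for all nonempty X ⊆ R_a, Y ⊆ C_b;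 in particular disc_k(A) ≤ disc_1(A). -/
open Finset

/-- The discrepancy `disc(X,Y;R_a,C_b) = |ρ(X,Y) − ρ(R_a,C_b)|·√(Vol(X)·Vol(Y))`. -/
noncomputable def discXY {m n : ℕ} (A : Matrix (Fin m) (Fin n) ℝ)
    (X : Finset (Fin m)) (Y : Finset (Fin n))
    (Ra : Finset (Fin m)) (Cb : Finset (Fin n)) : ℝ :=
  |density A X Y - density A Ra Cb| * Real.sqrt (rowVol A X * colVol A Y)

/-- A proper `k`-partition: all parts nonempty, pairwise disjoint, covering. -/
def IsProperPartition {α : Type*} {k : ℕ} (P : Fin k → Finset α) : Prop :=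
  (∀ a, (P a).Nonempty) ∧ (∀ a b, a ≠ b → Disjoint (P a) (P b)) ∧
    ∀ x, ∃ a, x ∈ P a

/-- `disc(A; R₁,…,R_k, C₁,…,C_k)`: the maximum of `disc(X,Y;R_a,C_b)` over all
`a, b` and nonempty `X ⊆ R_a`, `Y ⊆ C_b`. -/
noncomputable def discPartition {m n k : ℕ} (A : Matrix (Fin m) (Fin n) ℝ)
    (R : Fin k → Finset (Fin m)) (C : Fin k → Finset (Fin n)) : ℝ :=
  sSup { d : ℝ | ∃ (a b : Fin k) (X : Finset (Fin m)) (Y : Finset (Fin n)),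
    X.Nonempty ∧ X ⊆ R a ∧ Y.Nonempty ∧ Y ⊆ C b ∧ d = discXY A X Y (R a) (C b) }

/-- The minimum `k`-way discrepancy `disc_k(A)`. -/
noncomputable def minDisc {m n : ℕ} (k : ℕ) (A : Matrix (Fin m) (Fin n) ℝ) : ℝ :=
  sInf { d : ℝ | ∃ (R : Fin k → Finset (Fin m)) (C : Fin k → Finset (Fin n)),
    IsProperPartition R ∧ IsProperPartition C ∧ d = discPartition A R C }

theorem sum_parts_aux {α : Type*} [Fintype α] [DecidableEq α] {k : ℕ} {P : Fin k → Finset α}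
    (hP : IsProperPartition P) (f : α → ℝ) : ∑ c, ∑ x ∈ P c, f x = ∑ x, f x := by
  have h : (Finset.univ : Finset α) = Finset.univ.biUnion P := by
    ext x
    simpa using hP.2.2 x
  rw [h, Finset.sum_biUnion]
  intro a _ b _ hab
  exact hP.2.1 a b hab

theorem discXY_nonneg_aux {m n : ℕ} (A : Matrix (Fin m) (Fin n) ℝ)
    (X : Finset (Fin m)) (Y : Finset (Fin n))
    (Ra : Finset (Fin m)) (Cb : Finset (Fin n)) : 0 ≤ discXY A X Y Ra Cb := by
  unfold discXY
  positivity

theorem discPartition_nonneg_aux {m n k : ℕ} (A : Matrix (Fin m) (Fin n) ℝ)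
    (R : Fin k → Finset (Fin m)) (C : Fin k → Finset (Fin n)) : 0 ≤ discPartition A R C := by
  apply Real.sSup_nonneg
  rintro d ⟨a, b, X, Y, -, -, -, -, rfl⟩
  exact discXY_nonneg_aux _ _ _ _ _

theorem le_discPartition_aux {m n k : ℕ} (A : Matrix (Fin m) (Fin n) ℝ)
    (R : Fin k → Finset (Fin m)) (C : Fin k → Finset (Fin n)) (a b : Fin k)
    (X : Finset (Fin m)) (Y : Finset (Fin n)) (hX : X.Nonempty) (hXR : X ⊆ R a)
    (hY : Y.Nonempty) (hYC : Y ⊆ C b) :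
    discXY A X Y (R a) (C b) ≤ discPartition A R C := by
  apply le_csSup
  · apply Set.Finite.bddAbove
    apply (Set.finite_range (fun p : (Fin k × Fin k) × (Finset (Fin m) × Finset (Fin n)) =>
      discXY A p.2.1 p.2.2 (R p.1.1) (C p.1.2))).subset
    rintro d ⟨a, b, X, Y, -, -, -, -, rfl⟩
    exact ⟨((a, b), (X, Y)), rfl⟩
  · exact ⟨a, b, X, Y, hX, hXR, hY, hYC, rfl⟩

theorem one_part_aux {α : Type*} [Fintype α] {P : Fin 1 → Finset α}
    (hP : IsProperPartition P) (a : Fin 1) : P a = Finset.univ := by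
  ext x
  obtain ⟨b, hb⟩ := hP.2.2 x
  simpa [Subsingleton.elim a b] using hb

/-- For a `k`-way contracted independent table, the part densities are all 1,
the discrepancies within parts agree with those in the full table, and
`disc_k(A) ≤ disc_1(A)`. -/
theorem contracted_independent_disc {m n k : ℕ} (A : Matrix (Fin m) (Fin n) ℝ)
    (hA : ∀ i j, 0 ≤ A i j)
    (hsum : ∑ i, ∑ j, A i j = 1)
    (hrow : ∀ i, 0 < ∑ j, A i j)
    (hcol : ∀ j, 0 < ∑ i, A i j)
    (R : Fin k → Finset (Fin m)) (C : Fin k → Finset (Fin n))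
    (hR : IsProperPartition R) (hC : IsProperPartition C)
    (s : Fin k → Fin k → ℝ)
    (hs : ∀ a b, s a b = ∑ i ∈ R a, ∑ j ∈ C b, A i j)
    (hindep : ∀ a b, s a b = (∑ c, s a c) * (∑ c, s c b)) :
    (∀ a b, density A (R a) (C b) = 1) ∧
      (∀ (a b : Fin k) (X : Finset (Fin m)) (Y : Finset (Fin n)),
        X.Nonempty → X ⊆ R a → Y.Nonempty → Y ⊆ C b →
          discXY A X Y (R a) (C b) = discXY A X Y Finset.univ Finset.univ) ∧
      minDisc k A ≤ minDisc 1 A := by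
  have hrs : ∀ a, ∑ c, s a c = rowVol A (R a) := by
    intro a
    simp only [hs, rowVol]
    rw [Finset.sum_comm]
    exact Finset.sum_congr rfl fun i _ => sum_parts_aux hC _
  have hcs : ∀ b, ∑ c, s c b = colVol A (C b) := by
    intro b
    simp only [hs, colVol]
    rw [sum_parts_aux hR (fun i => ∑ j ∈ C b, A i j), Finset.sum_comm]
  have h1 : ∀ a b, density A (R a) (C b) = 1 := by
    intro a b
    have hr : 0 < rowVol A (R a) := Finset.sum_pos (fun i _ => hrow i) (hR.1 a)
    have hc : 0 < colVol A (C b) := Finset.sum_pos (fun i _ => hcol i) (hC.1 b)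
    have hcut : cut A (R a) (C b) = rowVol A (R a) * colVol A (C b) := by
      rw [← hrs, ← hcs, ← hindep, hs, cut]
    rw [density, hcut, div_self (mul_pos hr hc).ne']
  have hu : density A Finset.univ Finset.univ = 1 := by
    have hsum' : ∑ j, ∑ i, A i j = 1 := by rw [Finset.sum_comm]; exact hsum
    simp [density, cut, rowVol, colVol, hsum, hsum']
  have h2 : ∀ (a b : Fin k) (X : Finset (Fin m)) (Y : Finset (Fin n)),
      discXY A X Y (R a) (C b) = discXY A X Y Finset.univ Finset.univ := by
    intro a b X Y
    simp only [discXY, h1, hu]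
  refine ⟨h1, fun a b X Y _ _ _ _ => h2 a b X Y, ?_⟩
  have hm : (Finset.univ : Finset (Fin m)).Nonempty := by
    rw [Finset.nonempty_iff_ne_empty]
    intro h
    rw [h] at hsum
    simp at hsum
  have hn : (Finset.univ : Finset (Fin n)).Nonempty := by
    rw [Finset.nonempty_iff_ne_empty]
    intro h
    rw [h] at hsum
    simp at hsum
  have hle : minDisc k A ≤ discPartition A R C := by
    apply csInf_le
    · refine ⟨0, ?_⟩
      rintro d ⟨R', C', -, -, rfl⟩
      exact discPartition_nonneg_aux _ _ _
    · exact ⟨R, C, hR, hC, rfl⟩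
  refine hle.trans ?_
  apply le_csInf
  · refine ⟨_, fun _ => Finset.univ, fun _ => Finset.univ, ⟨fun _ => hm, ?_, ?_⟩,
      ⟨fun _ => hn, ?_, ?_⟩, rfl⟩
    · intro a b hab
      exact absurd (Subsingleton.elim a b) hab
    · intro x
      exact ⟨0, Finset.mem_univ x⟩
    · intro a b hab
      exact absurd (Subsingleton.elim a b) hab
    · intro x
      exact ⟨0, Finset.mem_univ x⟩
  · rintro d ⟨R', C', hR', hC', rfl⟩
    apply Real.sSup_le
    · rintro d ⟨a, b, X, Y, hX, -, hY, -, rfl⟩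
      rw [h2 a b X Y]
      have h := le_discPartition_aux A R' C' 0 0 X Y hX
        (by rw [one_part_aux hR']; exact Finset.subset_univ _) hY
        (by rw [one_part_aux hC']; exact Finset.subset_univ _)
      rwa [one_part_aux hR', one_part_aux hC'] at h
    · exact discPartition_nonneg_aux _ _ _
end
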